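/- For every MTL formula φ in negative normal form over a finite alphabet Σ, the infinite-timed-word language of the OCATA A_φ coincides with the semantics of φ: L^ω(A_φ) = ⟦φ⟧. -/

import Mathlib

namespace OcataPaper

open Set

/-! ### Clock constraints and transition formulas `Γ(L)` -/

inductive Cmp : Type
  | lt | le | gt | ge
deriving DecidableEq

def Cmp.eval : Cmp → ℝ → ℕ → Prop
  | .lt, v, c => v < c
  | .le, v, c => v ≤ c
  | .gt, v, c => v > c
  | .ge, v, c => v ≥ c

def Cmp.negate : Cmp → Cmp
  | .lt => .ge
  | .le => .gt
  | .gt => .le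
  | .ge => .lt

inductive TransFormula (L : Type*) : Type _
  | tt : TransFormula L
  | ff : TransFormula L
  | or (γ₁ γ₂ : TransFormula L) : TransFormula L
  | and (γ₁ γ₂ : TransFormula L) : TransFormula L
  | loc (ℓ : L) : TransFormula L
  | cmp (op : Cmp) (c : ℕ) : TransFormula L
  | reset (γ : TransFormula L) : TransFormula L

/-- The locations occurring in a formula of `Γ(L)`. -/
def TransFormula.locs {L : Type*} : TransFormula L → Set L
  | .tt => ∅
  | .ff => ∅
  | .or γ₁ γ₂ => γ₁.locs ∪ γ₂.locs
  | .and γ₁ γ₂ => γ₁.locs ∪ γ₂.locs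
  | .loc ℓ => {ℓ}
  | .cmp _ _ => ∅
  | .reset γ => γ.locs

/-- The constants occurring in clock constraints of a formula of `Γ(L)`. -/
def TransFormula.consts {L : Type*} : TransFormula L → Set ℕ
  | .tt => ∅
  | .ff => ∅
  | .or γ₁ γ₂ => γ₁.consts ∪ γ₂.consts
  | .and γ₁ γ₂ => γ₁.consts ∪ γ₂.consts
  | .loc _ => ∅
  | .cmp _ c => {c}
  | .reset γ => γ.consts

def TransFormula.map {L L' : Type*} (g : L → L') : TransFormula L → TransFormula L'
  | .tt => .tt
  | .ff => .ff
  | .or γ₁ γ₂ => .or (γ₁.map g) (γ₂.map g)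
  | .and γ₁ γ₂ => .and (γ₁.map g) (γ₂.map g)
  | .loc ℓ => .loc (g ℓ)
  | .cmp op c => .cmp op c
  | .reset γ => .reset (γ.map g)

/-- The dual `γ̄` of a formula of `Γ(L)`. -/
def TransFormula.dual {L : Type*} : TransFormula L → TransFormula L
  | .tt => .ff
  | .ff => .tt
  | .or γ₁ γ₂ => .and γ₁.dual γ₂.dual
  | .and γ₁ γ₂ => .or γ₁.dual γ₂.dual
  | .loc ℓ => .loc ℓ
  | .cmp op c => .cmp op.negate c
  | .reset γ => .reset γ.dual

/-! ### One-clock alternating timed automata -/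

structure OCATA (A : Type*) (L : Type*) where
  init : L
  final : Set L
  δ : L → A → TransFormula L

/-- The dual automaton `A^C`. -/
def OCATA.dual {A L : Type*} (Aut : OCATA A L) : OCATA A L where
  init := Aut.init
  final := Aut.finalᶜ
  δ := fun ℓ σ => (Aut.δ ℓ σ).dual

/-! ### The interval semantics -/

/-- A state of an OCATA in the interval semantics: a location and a clock interval. -/
abbrev OState (L : Type*) := L × Set ℝ

/-- The interval `[0,0]`. -/
def zeroItv : Set ℝ := {0}

/-- `I` is an interval with endpoints in `ℝ⁺`. -/
def IsItv (I : Set ℝ) : Prop :=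
  I.Nonempty ∧ I.OrdConnected ∧ BddAbove I ∧ ∀ x ∈ I, 0 ≤ x

/-- `C(ℓ)`: the intervals associated with location `ℓ` in `C`. -/
def locSet {L : Type*} (C : Set (OState L)) (ℓ : L) : Set (Set ℝ) := {I | (ℓ, I) ∈ C}

/-- Configurations: finite sets of states, intervals of a same location pairwise disjoint. -/
def IsConfig {L : Type*} (C : Set (OState L)) : Prop :=
  C.Finite ∧ (∀ s ∈ C, IsItv s.2) ∧
    ∀ ℓ I J, (ℓ, I) ∈ C → (ℓ, J) ∈ C → I ≠ J → Disjoint I J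

/-- `I + t`. -/
def shiftItv (I : Set ℝ) (t : ℝ) : Set ℝ := (fun x => x + t) '' I

/-- `C + t`. -/
def shiftCfg {L : Type*} (C : Set (OState L)) (t : ℝ) : Set (OState L) :=
  (fun s => (s.1, shiftItv s.2 t)) '' C

/-- The satisfaction relation `M ⊨_I γ`. -/
def Models {L : Type*} (M : Set (OState L)) : TransFormula L → Set ℝ → Prop
  | .tt, _ => True
  | .ff, _ => False
  | .or γ₁ γ₂, I => Models M γ₁ I ∨ Models M γ₂ I
  | .and γ₁ γ₂, I => Models M γ₁ I ∧ Models M γ₂ I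
  | .loc ℓ, I => (ℓ, I) ∈ M
  | .cmp op c, I => ∀ v ∈ I, op.eval v c
  | .reset γ, _ => Models M γ zeroItv

/-- `M` is a minimal model of `γ` w.r.t. `I`. -/
def IsMinModel {L : Type*} (M : Set (OState L)) (γ : TransFormula L) (I : Set ℝ) : Prop :=
  Models M γ I ∧ ∀ M' ⊂ M, ¬ Models M' γ I

/-- `‖E‖`: one clock per singular interval, two per non-singular interval. -/
noncomputable def nbClocks (E : Set (Set ℝ)) : ℕ :=
  ({I ∈ E | ∃ a : ℝ, I = {a}}).ncard + 2 * ({I ∈ E | ¬ ∃ a : ℝ, I = {a}}).ncard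

/-- `‖C‖ = Σ_ℓ ‖C(ℓ)‖`. -/
noncomputable def nbClocksC {L : Type*} (C : Set (OState L)) : ℕ :=
  ({s ∈ C | ∃ a : ℝ, s.2 = {a}}).ncard + 2 * ({s ∈ C | ¬ ∃ a : ℝ, s.2 = {a}}).ncard

/-- Approximation functions. -/
def IsApproxFun {L : Type*} (f : Set (OState L) → Set (Set (OState L))) : Prop :=
  ∀ C, IsConfig C → ∀ C' ∈ f C, IsConfig C' ∧ ∀ ℓ : L,
    nbClocks (locSet C' ℓ) ≤ nbClocks (locSet C ℓ) ∧
    (∀ I ∈ locSet C ℓ, ∃ J ∈ locSet C' ℓ, I ⊆ J) ∧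
    (∀ J ∈ locSet C' ℓ,
      (∃ I₁ ∈ locSet C ℓ, sInf J = sInf I₁) ∧ (∃ I₂ ∈ locSet C ℓ, sSup J = sSup I₂))

/-! ### Infinite timed words -/

/-- An infinite timed word: letters `σ₁σ₂⋯` and a non-decreasing time sequence `τ₁τ₂⋯`
(positions are `≥ 1`; by convention `τ₀ = 0`). -/
structure TimedWord (A : Type*) where
  letter : ℕ → A
  time : ℕ → ℝ
  time_zero : time 0 = 0
  mono : Monotone time

/-! ### `f`-runs (as DAGs, with the chosen minimal models recorded) -/

structure FRun {A L : Type*} (Aut : OCATA A L)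
    (f : Set (OState L) → Set (Set (OState L))) (θ : TimedWord A) where
  config : ℕ → Set (OState L)
  model : ℕ → OState L → Set (OState L)
  init : config 0 = {(Aut.init, zeroItv)}
  isConfig : ∀ i, IsConfig (config i)
  minModel : ∀ i, ∀ s ∈ shiftCfg (config i) (θ.time (i + 1) - θ.time i),
    IsMinModel (model i s) (Aut.δ s.1 (θ.letter (i + 1))) s.2
  succ : ∀ i, config (i + 1) ∈
    f (⋃ s ∈ shiftCfg (config i) (θ.time (i + 1) - θ.time i), model i s)

/-- The edges of the DAG of a run (via `dest`). -/
def FRun.Edge {A L : Type*} {Aut : OCATA A L}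
    {f : Set (OState L) → Set (Set (OState L))} {θ : TimedWord A}
    (ρ : FRun Aut f θ) (i : ℕ) (s s' : OState L) : Prop :=
  s ∈ ρ.config i ∧ s' ∈ ρ.config (i + 1) ∧
  ∃ I, (s'.1, I) ∈ ρ.model i (s.1, shiftItv s.2 (θ.time (i + 1) - θ.time i)) ∧ I ⊆ s'.2

/-- An (infinite) branch of the DAG of a run. -/
def FRun.IsBranch {A L : Type*} {Aut : OCATA A L}
    {f : Set (OState L) → Set (Set (OState L))} {θ : TimedWord A}
    (ρ : FRun Aut f θ) (β : ℕ → OState L) : Prop :=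
  β 0 = (Aut.init, zeroItv) ∧ ∀ i, ρ.Edge i (β i) (β (i + 1))

/-- Büchi acceptance: every infinite branch visits accepting locations infinitely often. -/
def FRun.Accepting {A L : Type*} {Aut : OCATA A L}
    {f : Set (OState L) → Set (Set (OState L))} {θ : TimedWord A}
    (ρ : FRun Aut f θ) : Prop :=
  ∀ β, ρ.IsBranch β → ∀ N, ∃ i, N ≤ i ∧ (β i).1 ∈ Aut.final

/-- The identity approximation function, giving the standard semantics. -/
def IdApprox {L : Type*} : Set (OState L) → Set (Set (OState L)) := fun C => {C}

/-- `L^ω_f(A)`. -/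
def FLang {A L : Type*} (Aut : OCATA A L)
    (f : Set (OState L) → Set (Set (OState L))) : Set (TimedWord A) :=
  {θ | ∃ ρ : FRun Aut f θ, ρ.Accepting}

/-! ### Tree-like OCATA -/

/-- `B ≼ B'` : some location of `B` occurs in `δ(ℓ,σ)` for some `ℓ ∈ B'`. -/
def BlockRel {A L : Type*} (Aut : OCATA A L) (B B' : Set L) : Prop :=
  ∃ σ : A, ∃ ℓ ∈ B', ∃ ℓ' ∈ B, ℓ' ∈ (Aut.δ ℓ σ).locs

/-- Tree-like OCATA: partition of the locations into blocks, each fully accepting or fully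
non-accepting, with the occurrence relation between blocks a partial order
(antisymmetric, and transitive up to reflexivity). -/
def IsTOCATA {A L : Type*} (Aut : OCATA A L) : Prop :=
  ∃ P : Set (Set L), Setoid.IsPartition P ∧
    (∀ B ∈ P, B ⊆ Aut.final ∨ B ∩ Aut.final = ∅) ∧
    (∀ B ∈ P, ∀ B' ∈ P, BlockRel Aut B B' → BlockRel Aut B' B → B = B') ∧
    (∀ B ∈ P, ∀ B' ∈ P, ∀ B'' ∈ P,
      BlockRel Aut B B' → BlockRel Aut B' B'' → B = B'' ∨ BlockRel Aut B B'')


/-! ### MTL / MITL formulas (in negative normal form when `IsNNF` holds) -/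

/-- An interval with endpoints in `ℕ ∪ {+∞}` (`hi = none` means `+∞`). -/
structure TimeItv where
  lo : ℕ
  hi : Option ℕ
  loIncl : Bool
  hiIncl : Bool
deriving DecidableEq

def TimeItv.Mem (I : TimeItv) (t : ℝ) : Prop :=
  (if I.loIncl then (I.lo : ℝ) ≤ t else (I.lo : ℝ) < t) ∧
  (match I.hi with
   | none => True
   | some h => if I.hiIncl then t ≤ (h : ℝ) else t < (h : ℝ))

def TimeItv.Nonsingular (I : TimeItv) : Prop :=
  match I.hi with
  | none => True
  | some h => I.lo < h

/-- The guard `x ∈ I` as a formula of `Γ(L)`. -/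
def TimeItv.memF {L : Type*} (I : TimeItv) : TransFormula L :=
  .and (if I.loIncl then .cmp .ge I.lo else .cmp .gt I.lo)
    (match I.hi with
     | none => .tt
     | some h => if I.hiIncl then .cmp .le h else .cmp .lt h)

/-- The guard `x ∉ I`. -/
def TimeItv.notMemF {L : Type*} (I : TimeItv) : TransFormula L :=
  .or (if I.loIncl then .cmp .lt I.lo else .cmp .le I.lo)
    (match I.hi with
     | none => .ff
     | some h => if I.hiIncl then .cmp .gt h else .cmp .ge h)

/-- The guard `x ≤ sup(I)`. -/
def TimeItv.leSupF {L : Type*} (I : TimeItv) : TransFormula L :=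
  match I.hi with
  | none => .tt
  | some h => .cmp .le h

/-- The guard `x > sup(I)`. -/
def TimeItv.gtSupF {L : Type*} (I : TimeItv) : TransFormula L :=
  match I.hi with
  | none => .ff
  | some h => .cmp .gt h

/-- `⌈inf(I)/|I|⌉` (0 when `I` is unbounded). -/
def TimeItv.ceilInfDiv (I : TimeItv) : ℕ :=
  match I.hi with
  | none => 0
  | some h => ⌈(I.lo : ℚ) / ((h : ℚ) - (I.lo : ℚ))⌉₊

/-- `⌈sup(I)/|I|⌉` (0 when `I` is unbounded). -/
def TimeItv.ceilSupDiv (I : TimeItv) : ℕ :=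
  match I.hi with
  | none => 0
  | some h => ⌈(h : ℚ) / ((h : ℚ) - (I.lo : ℚ))⌉₊

/-- MTL formulas; `untl` is `U_I` and `rele` is `Ũ_I`. -/
inductive MTL (A : Type*) : Type _
  | tt : MTL A
  | ff : MTL A
  | atom (a : A) : MTL A
  | neg (φ : MTL A) : MTL A
  | and (φ₁ φ₂ : MTL A) : MTL A
  | or (φ₁ φ₂ : MTL A) : MTL A
  | untl (φ₁ φ₂ : MTL A) (I : TimeItv) : MTL A
  | rele (φ₁ φ₂ : MTL A) (I : TimeItv) : MTL A

/-- The pointwise semantics `(θ, i) ⊨ φ` (`Ũ` by definition dual to `U`). -/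
def MTL.Sat {A : Type*} (θ : TimedWord A) : MTL A → ℕ → Prop
  | .tt, _ => True
  | .ff, _ => False
  | .atom a, i => θ.letter i = a
  | .neg φ, i => ¬ MTL.Sat θ φ i
  | .and φ₁ φ₂, i => MTL.Sat θ φ₁ i ∧ MTL.Sat θ φ₂ i
  | .or φ₁ φ₂, i => MTL.Sat θ φ₁ i ∨ MTL.Sat θ φ₂ i
  | .untl φ₁ φ₂ I, i => ∃ j, i ≤ j ∧ MTL.Sat θ φ₂ j ∧ I.Mem (θ.time j - θ.time i) ∧
      ∀ k, i ≤ k → k < j → MTL.Sat θ φ₁ k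
  | .rele φ₁ φ₂ I, i => ¬ ∃ j, i ≤ j ∧ ¬ MTL.Sat θ φ₂ j ∧ I.Mem (θ.time j - θ.time i) ∧
      ∀ k, i ≤ k → k < j → ¬ MTL.Sat θ φ₁ k

/-- `⟦φ⟧`. -/
def MTL.SemLang {A : Type*} (φ : MTL A) : Set (TimedWord A) := {θ | MTL.Sat θ φ 1}

/-- Negative normal form: negation only on letters. -/
def MTL.IsNNF {A : Type*} : MTL A → Prop
  | .neg (.atom _) => True
  | .neg _ => False
  | .and φ₁ φ₂ => φ₁.IsNNF ∧ φ₂.IsNNF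
  | .or φ₁ φ₂ => φ₁.IsNNF ∧ φ₂.IsNNF
  | .untl φ₁ φ₂ _ => φ₁.IsNNF ∧ φ₂.IsNNF
  | .rele φ₁ φ₂ _ => φ₁.IsNNF ∧ φ₂.IsNNF
  | _ => True

mutual
  /-- Negative normal form of a formula. -/
  def MTL.nnf {A : Type*} : MTL A → MTL A
    | .tt => .tt
    | .ff => .ff
    | .atom a => .atom a
    | .neg φ => MTL.nnfNeg φ
    | .and φ₁ φ₂ => .and (MTL.nnf φ₁) (MTL.nnf φ₂)
    | .or φ₁ φ₂ => .or (MTL.nnf φ₁) (MTL.nnf φ₂)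
    | .untl φ₁ φ₂ I => .untl (MTL.nnf φ₁) (MTL.nnf φ₂) I
    | .rele φ₁ φ₂ I => .rele (MTL.nnf φ₁) (MTL.nnf φ₂) I

  /-- Negative normal form of the negation of a formula. -/
  def MTL.nnfNeg {A : Type*} : MTL A → MTL A
    | .tt => .ff
    | .ff => .tt
    | .atom a => .neg (.atom a)
    | .neg φ => MTL.nnf φ
    | .and φ₁ φ₂ => .or (MTL.nnfNeg φ₁) (MTL.nnfNeg φ₂)
    | .or φ₁ φ₂ => .and (MTL.nnfNeg φ₁) (MTL.nnfNeg φ₂)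
    | .untl φ₁ φ₂ I => .rele (MTL.nnfNeg φ₁) (MTL.nnfNeg φ₂) I
    | .rele φ₁ φ₂ I => .untl (MTL.nnfNeg φ₁) (MTL.nnfNeg φ₂) I
end

/-- Outermost connective is `U` or `Ũ`. -/
def MTL.IsTemporal {A : Type*} : MTL A → Prop
  | .untl _ _ _ => True
  | .rele _ _ _ => True
  | _ => False

def MTL.IsRelease {A : Type*} : MTL A → Prop
  | .rele _ _ _ => True
  | _ => False

/-- Subformulas. -/
def MTL.Subf {A : Type*} : MTL A → Set (MTL A)
  | .tt => {MTL.tt}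
  | .ff => {MTL.ff}
  | .atom a => {MTL.atom a}
  | .neg φ => insert (MTL.neg φ) (MTL.Subf φ)
  | .and φ₁ φ₂ => insert (MTL.and φ₁ φ₂) (MTL.Subf φ₁ ∪ MTL.Subf φ₂)
  | .or φ₁ φ₂ => insert (MTL.or φ₁ φ₂) (MTL.Subf φ₁ ∪ MTL.Subf φ₂)
  | .untl φ₁ φ₂ I => insert (MTL.untl φ₁ φ₂ I) (MTL.Subf φ₁ ∪ MTL.Subf φ₂)
  | .rele φ₁ φ₂ I => insert (MTL.rele φ₁ φ₂ I) (MTL.Subf φ₁ ∪ MTL.Subf φ₂)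

/-- MITL wellformedness: every interval is non-singular. -/
def MTL.MITLwf {A : Type*} : MTL A → Prop
  | .neg φ => MTL.MITLwf φ
  | .and φ₁ φ₂ => φ₁.MITLwf ∧ φ₂.MITLwf
  | .or φ₁ φ₂ => φ₁.MITLwf ∧ φ₂.MITLwf
  | .untl φ₁ φ₂ I => I.Nonsingular ∧ φ₁.MITLwf ∧ φ₂.MITLwf
  | .rele φ₁ φ₂ I => I.Nonsingular ∧ φ₁.MITLwf ∧ φ₂.MITLwf
  | _ => True

/-! ### The Ouaknine–Worrell construction `A_φ` -/

/-- `δ(φ,σ)`, with locations named by raw formulas. -/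
def MTL.trans {A : Type*} [DecidableEq A] : MTL A → A → TransFormula (MTL A)
  | .tt, _ => .tt
  | .ff, _ => .ff
  | .atom a, σ => if a = σ then .tt else .ff
  | .neg (.atom a), σ => if a = σ then .ff else .tt
  | .neg _, _ => .ff
  | .and φ₁ φ₂, σ => .and (MTL.trans φ₁ σ) (MTL.trans φ₂ σ)
  | .or φ₁ φ₂, σ => .or (MTL.trans φ₁ σ) (MTL.trans φ₂ σ)
  | .untl φ₁ φ₂ I, σ =>
      .or (.and (.reset (MTL.trans φ₂ σ)) I.memF)
          (.and (.reset (MTL.trans φ₁ σ)) (.and (.loc (.untl φ₁ φ₂ I)) I.leSupF))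
  | .rele φ₁ φ₂ I, σ =>
      .and (.or (.reset (MTL.trans φ₂ σ)) I.notMemF)
           (.or (.reset (MTL.trans φ₁ σ)) (.or (.loc (.rele φ₁ φ₂ I)) I.gtSupF))

/-- Locations of `A_φ`: `φ_init` (i.e. `none`) together with the `U`/`Ũ`-subformulas of `φ`. -/
def MTLLoc {A : Type*} (φ : MTL A) : Type _ :=
  Option {ψ : MTL A // ψ ∈ MTL.Subf φ ∧ MTL.IsTemporal ψ}

open Classical in
noncomputable def embedLoc {A : Type*} (φ : MTL A) (ψ : MTL A) : MTLLoc φ :=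
  if h : ψ ∈ MTL.Subf φ ∧ MTL.IsTemporal ψ then some ⟨ψ, h⟩ else none

/-- The OCATA `A_φ`. -/
noncomputable def mtlOCATA {A : Type*} [DecidableEq A] (φ : MTL A) : OCATA A (MTLLoc φ) where
  init := none
  final := {l | ∃ p, l = some p ∧ MTL.IsRelease p.1}
  δ := fun l σ =>
    match l with
    | none => .reset ((MTL.trans φ σ).map (embedLoc φ))
    | some p => (MTL.trans p.1 σ).map (embedLoc φ)

/-! ### The bound `M(φ)` -/

/-- `(M(φ), M^∞(φ), M^1(φ))`. -/
def MTL.Mtriple {A : Type*} : MTL A → ℕ × ℕ × ℕ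
  | .and φ₁ φ₂ =>
      let t₁ := MTL.Mtriple φ₁; let t₂ := MTL.Mtriple φ₂
      (max 2 (t₁.2.2 + t₂.2.2), t₁.2.1 + t₂.2.1, t₁.2.2 + t₂.2.2)
  | .or φ₁ φ₂ =>
      let t₁ := MTL.Mtriple φ₁; let t₂ := MTL.Mtriple φ₂
      (max 2 (max t₁.2.2 t₂.2.2), max t₁.2.1 t₂.2.1, max t₁.2.2 t₂.2.2)
  | .untl φ₁ φ₂ I =>
      let t₁ := MTL.Mtriple φ₁; let t₂ := MTL.Mtriple φ₂
      (max 2 (t₁.2.1 + t₂.2.2 + 1), (4 * I.ceilInfDiv + 2) + t₁.2.1 + t₂.2.1,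
        t₁.2.1 + t₂.2.2 + 1)
  | .rele φ₁ φ₂ I =>
      let t₁ := MTL.Mtriple φ₁; let t₂ := MTL.Mtriple φ₂
      (max 2 (t₁.2.2 + t₂.2.1 + 1), (2 * I.ceilSupDiv + 2) + t₁.2.1 + t₂.2.1,
        t₁.2.2 + t₂.2.1 + 1)
  | _ => (2, 0, 0)

/-- `M(φ)`. -/
def MTL.M {A : Type*} (φ : MTL A) : ℕ := φ.Mtriple.1

/-! ### The `Merge` operation and the approximation functions `F^k` -/

/-- `I < J` for intervals. -/
def ItvLT (I J : Set ℝ) : Prop := ∀ x ∈ I, ∀ y ∈ J, x < y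

/-- `E'` is obtained from `E` by merging the smallest interval `[0,0]` with
the next interval `I₁` into `[0, sup I₁]`. -/
def MergedOf (E E' : Set (Set ℝ)) : Prop :=
  zeroItv ∈ E ∧ ∃ I₁ ∈ E, I₁ ≠ zeroItv ∧
    (∀ J ∈ E, J ≠ zeroItv → J ≠ I₁ → ItvLT I₁ J) ∧
    E' = insert (Set.Icc 0 (sSup I₁)) (E \ {zeroItv, I₁})

/-- `E' ∈ {Merge(E), E}`. -/
def MergeChoice (E E' : Set (Set ℝ)) : Prop := E' = E ∨ MergedOf E E'

/-- `Merge(C,k)`. -/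
def MergeCk {L : Type*} (C : Set (OState L)) (k : ℕ) : Set (Set (OState L)) :=
  {C' | nbClocksC C' ≤ k ∧ ∀ ℓ, MergeChoice (locSet C ℓ) (locSet C' ℓ)}

/-- Grouping all the intervals of each location into a single interval. -/
def squash {L : Type*} (C : Set (OState L)) : Set (OState L) :=
  {s | (locSet C s.1).Nonempty ∧
    s.2 = Set.Icc (sInf (⋃ I ∈ locSet C s.1, I)) (sSup (⋃ I ∈ locSet C s.1, I))}

open Classical in
/-- The approximation function `F^k`. -/
noncomputable def Fk {L : Type*} (k : ℕ) (C : Set (OState L)) : Set (Set (OState L)) :=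
  if (MergeCk C k).Nonempty then MergeCk C k else {squash C}

/-! ### The Miyano–Hayashi construction -/

/-- Marked configurations. -/
abbrev MState (L : Type*) := Set (L × Set ℝ × Bool)

/-- The underlying configuration. -/
def MState.conf {L : Type*} (s : MState L) : Set (OState L) := (fun x => (x.1, x.2.1)) '' s

/-- All markers are `⊤`. -/
def MState.allTrue {L : Type*} (s : MState L) : Prop := ∀ x ∈ s, x.2.2 = true

def shiftM {L : Type*} (s : MState L) (t : ℝ) : MState L :=
  (fun x => (x.1, shiftItv x.2.1 t, x.2.2)) '' s

/-- Reset all markers to `⊥`. -/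
def resetMarksM {L : Type*} (s : MState L) : MState L := (fun x => (x.1, x.2.1, false)) '' s

/-- A discrete Miyano–Hayashi step (from a non-accepting marked state). -/
def MHStepCore {A L : Type*} (Aut : OCATA A L) (f : Set (OState L) → Set (Set (OState L)))
    (σ : A) (s s' : MState L) : Prop :=
  ∃ m : OState L → Set (OState L),
    (∀ q ∈ MState.conf s, IsMinModel (m q) (Aut.δ q.1 σ) q.2) ∧
    MState.conf s' ∈ f (⋃ q ∈ MState.conf s, m q) ∧
    (∀ ℓ I b₁ b₂, (ℓ, I, b₁) ∈ s' → (ℓ, I, b₂) ∈ s' → b₁ = b₂) ∧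
    (∀ x ∈ s', x.1 ∈ Aut.final → x.2.2 = true) ∧
    (∀ x ∈ s', x.1 ∉ Aut.final →
      (x.2.2 = false ↔ ∃ ℓ I, (ℓ, I, false) ∈ s ∧ ∃ I', (x.1, I') ∈ m (ℓ, I) ∧ I' ⊆ x.2.1))

/-- A discrete step of `MH(A,f)` (markers of an accepting state are first reset to `⊥`). -/
def MHStep {A L : Type*} (Aut : OCATA A L) (f : Set (OState L) → Set (Set (OState L)))
    (σ : A) (s s' : MState L) : Prop :=
  (MState.allTrue s ∧ MHStepCore Aut f σ (resetMarksM s) s') ∨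
  (¬ MState.allTrue s ∧ MHStepCore Aut f σ s s')

structure MHRun {A L : Type*} (Aut : OCATA A L)
    (f : Set (OState L) → Set (Set (OState L))) (θ : TimedWord A) where
  st : ℕ → MState L
  init : st 0 = {(Aut.init, zeroItv, false)}
  step : ∀ i, MHStep Aut f (θ.letter (i + 1)) (shiftM (st i) (θ.time (i + 1) - θ.time i))
    (st (i + 1))

/-- Büchi acceptance on `α` (all markers `⊤`). -/
def MHRun.Accepting {A L : Type*} {Aut : OCATA A L}
    {f : Set (OState L) → Set (Set (OState L))} {θ : TimedWord A}
    (ρ : MHRun Aut f θ) : Prop :=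
  ∀ N, ∃ i, N ≤ i ∧ MState.allTrue (ρ.st i)

/-- `L^ω(MH(A,f))`. -/
def MHLang {A L : Type*} (Aut : OCATA A L)
    (f : Set (OState L) → Set (Set (OState L))) : Set (TimedWord A) :=
  {θ | ∃ ρ : MHRun Aut f θ, ρ.Accepting}

/-! ### Büchi timed automata -/

/-- A Büchi timed automaton with locations `Q` and clocks `X`; a transition
`(b, σ, g, r, b')` has guard `g` (a finite conjunction of clock constraints) and reset `r`. -/
structure TBA (A : Type*) (Q : Type*) (X : Type*) where
  init : Q
  final : Set Q
  trans : Set (Q × A × List (X × Cmp × ℕ) × Set X × Q)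

def GuardSat {X : Type*} (g : List (X × Cmp × ℕ)) (v : X → ℝ) : Prop :=
  ∀ c ∈ g, Cmp.eval c.2.1 (v c.1) c.2.2

open Classical in
noncomputable def resetVal {X : Type*} (r : Set X) (v : X → ℝ) : X → ℝ :=
  fun x => if x ∈ r then 0 else v x

structure TBARun {A Q X : Type*} (B : TBA A Q X) (θ : TimedWord A) where
  loc : ℕ → Q
  val : ℕ → X → ℝ
  init_loc : loc 0 = B.init
  init_val : val 0 = fun _ => 0
  step : ∀ i, ∃ g r, (loc i, θ.letter (i + 1), g, r, loc (i + 1)) ∈ B.trans ∧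
    GuardSat g (fun x => val i x + (θ.time (i + 1) - θ.time i)) ∧
    val (i + 1) = resetVal r (fun x => val i x + (θ.time (i + 1) - θ.time i))

def TBARun.Accepting {A Q X : Type*} {B : TBA A Q X} {θ : TimedWord A}
    (ρ : TBARun B θ) : Prop :=
  ∀ N, ∃ i, N ≤ i ∧ ρ.loc i ∈ B.final

/-- `L^ω(B)`. -/
def TBALang {A Q X : Type*} (B : TBA A Q X) : Set (TimedWord A) :=
  {θ | ∃ ρ : TBARun B θ, ρ.Accepting}

/-! ### Clocked semantics of the temporal operators -/

/-- `P U_I Q` at position `n`, for a clock whose current value is `w`. -/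
def untilAt {A : Type*} (θ : TimedWord A) (P Q : ℕ → Prop) (I : TimeItv) (n : ℕ) (w : ℝ) : Prop :=
  ∃ j, n ≤ j ∧ Q j ∧ I.Mem (w + (θ.time j - θ.time n)) ∧ ∀ k, n ≤ k → k < j → P k

/-- The guard `x ≤ sup(I)` on a clock value. -/
def TimeItv.LeSup (I : TimeItv) (w : ℝ) : Prop :=
  match I.hi with
  | none => True
  | some h => w ≤ (h : ℝ)

theorem TimeItv.Mem.leSup {I : TimeItv} {w t : ℝ} (h : I.Mem t) (hw : w ≤ t) : I.LeSup w := by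
  rcases I with ⟨lo, _ | hi, li, hinc⟩
  · trivial
  · have h2 := h.2
    simp only at h2
    simp only [LeSup]
    split at h2 <;> linarith

theorem untilAt_step {A : Type*} (θ : TimedWord A) (P Q : ℕ → Prop) (I : TimeItv) (n : ℕ) (w : ℝ) :
    untilAt θ P Q I n w ↔ (Q n ∧ I.Mem w) ∨
      (P n ∧ I.LeSup w ∧ untilAt θ P Q I (n + 1) (w + (θ.time (n + 1) - θ.time n))) := by
  constructor
  · rintro ⟨j, hj, hQ, hI, hP⟩
    rcases hj.eq_or_lt with rfl | hlt
    · left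
      exact ⟨hQ, by simpa using hI⟩
    · right
      refine ⟨hP n le_rfl hlt, hI.leSup ?_, j, hlt, hQ, ?_, fun k hk => hP k (by omega)⟩
      · linarith [θ.mono hj]
      · convert hI using 1
        ring
  · rintro (⟨hQ, hI⟩ | ⟨hP, -, j, hj, hQ, hI, hP'⟩)
    · exact ⟨n, le_rfl, hQ, by simpa using hI, fun k h1 h2 => by omega⟩
    · refine ⟨j, by omega, hQ, ?_, fun k h1 h2 => ?_⟩
      · convert hI using 1
        ring
      · rcases h1.eq_or_lt with rfl | h
        · exact hP
        · exact hP' k h h2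

/-- The obligation of a formula at position `n`, its outermost temporal operator being
evaluated with clock value `w`. -/
def MTL.Obl {A : Type*} (θ : TimedWord A) (ψ : MTL A) (n : ℕ) (w : ℝ) : Prop :=
  match ψ with
  | .untl φ₁ φ₂ I => untilAt θ (MTL.Sat θ φ₁) (MTL.Sat θ φ₂) I n w
  | .rele φ₁ φ₂ I => ¬ untilAt θ (fun k => ¬ MTL.Sat θ φ₁ k) (fun k => ¬ MTL.Sat θ φ₂ k) I n w
  | ψ => MTL.Sat θ ψ n

theorem MTL.obl_zero {A : Type*} (θ : TimedWord A) (ψ : MTL A) (n : ℕ) :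
    ψ.Obl θ n 0 ↔ MTL.Sat θ ψ n := by
  cases ψ <;> simp [MTL.Obl, MTL.Sat, untilAt]

theorem MTL.obl_untl {A : Type*} (θ : TimedWord A) (φ₁ φ₂ : MTL A) (I : TimeItv) (n : ℕ) (w : ℝ) :
    (MTL.untl φ₁ φ₂ I).Obl θ n w ↔ (MTL.Sat θ φ₂ n ∧ I.Mem w) ∨ (MTL.Sat θ φ₁ n ∧
      (MTL.untl φ₁ φ₂ I).Obl θ (n + 1) (w + (θ.time (n + 1) - θ.time n)) ∧ I.LeSup w) := by
  simp only [MTL.Obl]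
  rw [untilAt_step]
  tauto

theorem MTL.obl_rele {A : Type*} (θ : TimedWord A) (φ₁ φ₂ : MTL A) (I : TimeItv) (n : ℕ) (w : ℝ) :
    (MTL.rele φ₁ φ₂ I).Obl θ n w ↔ (MTL.Sat θ φ₂ n ∨ ¬ I.Mem w) ∧ (MTL.Sat θ φ₁ n ∨
      (MTL.rele φ₁ φ₂ I).Obl θ (n + 1) (w + (θ.time (n + 1) - θ.time n)) ∨ ¬ I.LeSup w) := by
  simp only [MTL.Obl]
  rw [untilAt_step]
  tauto

/-! ### Models of the transition formulas on singular intervals -/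

theorem models_map_memF {L L' : Type*} (g : L → L') (M : Set (OState L')) (I : TimeItv) (w : ℝ) :
    Models M ((I.memF : TransFormula L).map g) {w} ↔ I.Mem w := by
  rcases I with ⟨lo, _ | hi, _ | _, _ | _⟩ <;>
    simp [TimeItv.memF, TimeItv.Mem, TransFormula.map, Models, Cmp.eval]

theorem models_map_notMemF {L L' : Type*} (g : L → L') (M : Set (OState L')) (I : TimeItv)
    (w : ℝ) : Models M ((I.notMemF : TransFormula L).map g) {w} ↔ ¬ I.Mem w := by
  rcases I with ⟨lo, _ | hi, _ | _, _ | _⟩ <;>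
    simp [TimeItv.notMemF, TimeItv.Mem, TransFormula.map, Models, Cmp.eval, -not_and, not_and_or]

theorem models_map_leSupF {L L' : Type*} (g : L → L') (M : Set (OState L')) (I : TimeItv) (w : ℝ) :
    Models M ((I.leSupF : TransFormula L).map g) {w} ↔ I.LeSup w := by
  rcases I with ⟨lo, _ | hi, _ | _, _ | _⟩ <;>
    simp [TimeItv.leSupF, TimeItv.LeSup, TransFormula.map, Models, Cmp.eval]

theorem models_map_gtSupF {L L' : Type*} (g : L → L') (M : Set (OState L')) (I : TimeItv) (w : ℝ) :
    Models M ((I.gtSupF : TransFormula L).map g) {w} ↔ ¬ I.LeSup w := by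
  rcases I with ⟨lo, _ | hi, _ | _, _ | _⟩ <;>
    simp [TimeItv.gtSupF, TimeItv.LeSup, TransFormula.map, Models, Cmp.eval]

theorem models_trans_untl {A L' : Type*} [DecidableEq A] (g : MTL A → L') (M : Set (OState L'))
    (φ₁ φ₂ : MTL A) (I : TimeItv) (σ : A) (w : ℝ) :
    Models M ((MTL.trans (.untl φ₁ φ₂ I) σ).map g) {w} ↔
      (Models M ((MTL.trans φ₂ σ).map g) {0} ∧ I.Mem w) ∨
      (Models M ((MTL.trans φ₁ σ).map g) {0} ∧ (g (.untl φ₁ φ₂ I), {w}) ∈ M ∧ I.LeSup w) := by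
  rw [← models_map_memF g M I w, ← models_map_leSupF g M I w]
  rfl

theorem models_trans_rele {A L' : Type*} [DecidableEq A] (g : MTL A → L') (M : Set (OState L'))
    (φ₁ φ₂ : MTL A) (I : TimeItv) (σ : A) (w : ℝ) :
    Models M ((MTL.trans (.rele φ₁ φ₂ I) σ).map g) {w} ↔
      (Models M ((MTL.trans φ₂ σ).map g) {0} ∨ ¬ I.Mem w) ∧
      (Models M ((MTL.trans φ₁ σ).map g) {0} ∨ (g (.rele φ₁ φ₂ I), {w}) ∈ M ∨ ¬ I.LeSup w) := by
  rw [← models_map_notMemF g M I w, ← models_map_gtSupF g M I w]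
  rfl

/-! ### Subformulas -/

theorem MTL.self_mem_subf {A : Type*} (ψ : MTL A) : ψ ∈ MTL.Subf ψ := by
  cases ψ <;> simp [MTL.Subf]

theorem MTL.subf_trans {A : Type*} {χ ψ : MTL A} (h : χ ∈ MTL.Subf ψ) :
    MTL.Subf χ ⊆ MTL.Subf ψ := by
  induction ψ with
  | tt => rw [show χ = .tt from h]
  | ff => rw [show χ = .ff from h]
  | atom a => rw [show χ = .atom a from h]
  | neg ψ ih =>
    rcases h with rfl | h
    · exact subset_rfl
    · exact (ih h).trans (subset_insert _ _)
  | and ψ₁ ψ₂ ih₁ ih₂ | or ψ₁ ψ₂ ih₁ ih₂ | untl ψ₁ ψ₂ I ih₁ ih₂ | rele ψ₁ ψ₂ I ih₁ ih₂ =>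
    rcases h with rfl | h | h
    · exact subset_rfl
    · exact (ih₁ h).trans (subset_union_left.trans (subset_insert _ _))
    · exact (ih₂ h).trans (subset_union_right.trans (subset_insert _ _))

theorem MTL.sizeOf_le_of_mem_subf {A : Type*} {χ ψ : MTL A} (h : χ ∈ MTL.Subf ψ) :
    sizeOf χ ≤ sizeOf ψ := by
  induction ψ with
  | tt => rw [show χ = .tt from h]
  | ff => rw [show χ = .ff from h]
  | atom a => rw [show χ = .atom a from h]
  | neg ψ ih =>
    rcases h with rfl | h
    · exact le_rfl
    · have := ih h
      simp only [MTL.neg.sizeOf_spec]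
      omega
  | and ψ₁ ψ₂ ih₁ ih₂ | or ψ₁ ψ₂ ih₁ ih₂ | untl ψ₁ ψ₂ I ih₁ ih₂ | rele ψ₁ ψ₂ I ih₁ ih₂ =>
    rcases h with rfl | h | h
    · exact le_rfl
    · have := ih₁ h
      simp only [MTL.and.sizeOf_spec, MTL.or.sizeOf_spec, MTL.untl.sizeOf_spec,
        MTL.rele.sizeOf_spec]
      omega
    · have := ih₂ h
      simp only [MTL.and.sizeOf_spec, MTL.or.sizeOf_spec, MTL.untl.sizeOf_spec,
        MTL.rele.sizeOf_spec]
      omega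

theorem MTL.finite_subf {A : Type*} (ψ : MTL A) : (MTL.Subf ψ).Finite := by
  induction ψ <;> simp_all [MTL.Subf]

theorem MTL.IsNNF.of_temporal_mem_subf {A : Type*} {χ ψ : MTL A} (hψ : ψ.IsNNF)
    (h : χ ∈ MTL.Subf ψ) (hχ : χ.IsTemporal) : χ.IsNNF := by
  induction ψ with
  | tt => rwa [show χ = .tt from h]
  | ff => rwa [show χ = .ff from h]
  | atom a => rwa [show χ = .atom a from h]
  | neg ψ ih =>
    cases ψ with
    | atom a =>
      rcases h with rfl | rfl
      · exact hχ.elim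
      · exact hχ.elim
    | _ => exact hψ.elim
  | and ψ₁ ψ₂ ih₁ ih₂ | or ψ₁ ψ₂ ih₁ ih₂ | untl ψ₁ ψ₂ I ih₁ ih₂ | rele ψ₁ ψ₂ I ih₁ ih₂ =>
    rcases h with rfl | h | h
    · exact hψ
    · exact ih₁ hψ.1 h
    · exact ih₂ hψ.2 h

instance {A : Type*} (φ : MTL A) : Finite (MTLLoc φ) := by
  have : Finite {ψ : MTL A // ψ ∈ MTL.Subf φ ∧ MTL.IsTemporal ψ} :=
    ((MTL.finite_subf φ).subset fun _ h => h.1 :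
      {ψ : MTL A | ψ ∈ MTL.Subf φ ∧ MTL.IsTemporal ψ}.Finite).to_subtype
  unfold MTLLoc
  infer_instance

theorem embedLoc_val {A : Type*} {φ : MTL A} (p : {ψ : MTL A // ψ ∈ MTL.Subf φ ∧ ψ.IsTemporal}) :
    embedLoc φ p.1 = some p := dif_pos p.2

/-! ### Transition formulas and satisfaction -/

/-- What remains of `χ` after position `n` has been read with clock value `w`. -/
def MTL.OblNext {A : Type*} (θ : TimedWord A) (χ : MTL A) (n : ℕ) (w : ℝ) : Prop :=
  χ.Obl θ (n + 1) (w + (θ.time (n + 1) - θ.time n))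

theorem MTL.sat_of_models_trans {A L' : Type*} [DecidableEq A] {θ : TimedWord A} {g : MTL A → L'}
    {M : Set (OState L')} {n : ℕ} {ψ : MTL A} (hψ : ψ.IsNNF)
    (hM : ∀ χ ∈ MTL.Subf ψ, χ.IsTemporal → (g χ, {0}) ∈ M → χ.OblNext θ n 0)
    (h : Models M ((MTL.trans ψ (θ.letter n)).map g) {0}) : MTL.Sat θ ψ n := by
  induction ψ with
  | tt => trivial
  | ff => exact h.elim
  | atom a =>
    by_contra hne
    rw [MTL.trans, if_neg fun e => hne e.symm] at h
    exact h
  | neg ψ ih =>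
    cases ψ with
    | atom a =>
      intro e
      rw [MTL.trans, if_pos (Eq.symm e)] at h
      exact h
    | _ => exact hψ.elim
  | and ψ₁ ψ₂ ih₁ ih₂ =>
    exact ⟨ih₁ hψ.1 (fun χ hχ => hM χ (.inr (.inl hχ))) h.1,
      ih₂ hψ.2 (fun χ hχ => hM χ (.inr (.inr hχ))) h.2⟩
  | or ψ₁ ψ₂ ih₁ ih₂ =>
    exact h.imp (ih₁ hψ.1 (fun χ hχ => hM χ (.inr (.inl hχ))))
      (ih₂ hψ.2 (fun χ hχ => hM χ (.inr (.inr hχ))))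
  | untl ψ₁ ψ₂ I ih₁ ih₂ =>
    rw [models_trans_untl] at h
    rw [← MTL.obl_zero, MTL.obl_untl]
    exact h.imp (And.imp_left (ih₂ hψ.2 (fun χ hχ => hM χ (.inr (.inr hχ)))))
      (And.imp (ih₁ hψ.1 (fun χ hχ => hM χ (.inr (.inl hχ))))
        (And.imp_left (hM _ (MTL.self_mem_subf _) trivial)))
  | rele ψ₁ ψ₂ I ih₁ ih₂ =>
    rw [models_trans_rele] at h
    rw [← MTL.obl_zero, MTL.obl_rele]
    exact h.imp (Or.imp_left (ih₂ hψ.2 (fun χ hχ => hM χ (.inr (.inr hχ)))))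
      (Or.imp (ih₁ hψ.1 (fun χ hχ => hM χ (.inr (.inl hχ))))
        (Or.imp_left (hM _ (MTL.self_mem_subf _) trivial)))

theorem MTL.models_trans_of_sat {A L' : Type*} [DecidableEq A] {θ : TimedWord A} {g : MTL A → L'}
    {M : Set (OState L')} {n : ℕ} {ψ : MTL A} (hψ : ψ.IsNNF)
    (hM : ∀ χ ∈ MTL.Subf ψ, χ.IsTemporal → χ.OblNext θ n 0 → (g χ, {0}) ∈ M)
    (h : MTL.Sat θ ψ n) : Models M ((MTL.trans ψ (θ.letter n)).map g) {0} := by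
  induction ψ with
  | tt => trivial
  | ff => exact h.elim
  | atom a =>
    rw [MTL.trans, if_pos (Eq.symm h)]
    trivial
  | neg ψ ih =>
    cases ψ with
    | atom a =>
      rw [MTL.trans, if_neg fun e => h (Eq.symm e)]
      trivial
    | _ => exact hψ.elim
  | and ψ₁ ψ₂ ih₁ ih₂ =>
    exact ⟨ih₁ hψ.1 (fun χ hχ => hM χ (.inr (.inl hχ))) h.1,
      ih₂ hψ.2 (fun χ hχ => hM χ (.inr (.inr hχ))) h.2⟩
  | or ψ₁ ψ₂ ih₁ ih₂ =>
    exact Or.imp (ih₁ hψ.1 (fun χ hχ => hM χ (.inr (.inl hχ))))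
      (ih₂ hψ.2 (fun χ hχ => hM χ (.inr (.inr hχ)))) h
  | untl ψ₁ ψ₂ I ih₁ ih₂ =>
    rw [models_trans_untl]
    rw [← MTL.obl_zero, MTL.obl_untl] at h
    exact h.imp (And.imp_left (ih₂ hψ.2 (fun χ hχ => hM χ (.inr (.inr hχ)))))
      (And.imp (ih₁ hψ.1 (fun χ hχ => hM χ (.inr (.inl hχ))))
        (And.imp_left (hM _ (MTL.self_mem_subf _) trivial)))
  | rele ψ₁ ψ₂ I ih₁ ih₂ =>
    rw [models_trans_rele]
    rw [← MTL.obl_zero, MTL.obl_rele] at h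
    exact h.imp (Or.imp_left (ih₂ hψ.2 (fun χ hχ => hM χ (.inr (.inr hχ)))))
      (Or.imp (ih₁ hψ.1 (fun χ hχ => hM χ (.inr (.inl hχ))))
        (Or.imp_left (hM _ (MTL.self_mem_subf _) trivial)))

/-! ### Generalities on runs -/

theorem Models.exists_isMinModel_subset {L : Type*} {γ : TransFormula L} {I : Set ℝ}
    {M : Set (OState L)} (hfin : M.Finite) (h : Models M γ I) : ∃ M' ⊆ M, IsMinModel M' γ I := by
  obtain ⟨M', hle, hmin⟩ := (hfin.finite_subsets.subset
    (fun _ h => h.1) : {N | N ⊆ M ∧ Models N γ I}.Finite).exists_le_minimal ⟨subset_rfl, h⟩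
  exact ⟨M', hle, hmin.prop.2, fun N hN hm =>
    hN.2 (hmin.le_of_le ⟨hN.1.trans hle, hm⟩ hN.1)⟩

theorem shiftItv_singleton (v t : ℝ) : shiftItv {v} t = {v + t} := by simp [shiftItv]

theorem mem_shiftCfg {L : Type*} {C : Set (OState L)} {s : OState L} (hs : s ∈ C) (t : ℝ) :
    (s.1, shiftItv s.2 t) ∈ shiftCfg C t := ⟨s, hs, rfl⟩

theorem FRun.config_succ {A L : Type*} {Aut : OCATA A L} {θ : TimedWord A}
    (ρ : FRun Aut IdApprox θ) (i : ℕ) : ρ.config (i + 1) =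
      ⋃ s ∈ shiftCfg (ρ.config i) (θ.time (i + 1) - θ.time i), ρ.model i s := ρ.succ i

theorem FRun.mem_config_succ {A L : Type*} {Aut : OCATA A L} {θ : TimedWord A}
    (ρ : FRun Aut IdApprox θ) {i : ℕ} {s s' : OState L} (hs : s ∈ ρ.config i)
    (h : s' ∈ ρ.model i (s.1, shiftItv s.2 (θ.time (i + 1) - θ.time i))) :
    s' ∈ ρ.config (i + 1) := by
  rw [ρ.config_succ]
  exact mem_biUnion (mem_shiftCfg hs _) h

theorem FRun.edge_of_mem_model {A L : Type*} {Aut : OCATA A L} {θ : TimedWord A}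
    (ρ : FRun Aut IdApprox θ) {i : ℕ} {s s' : OState L} (hs : s ∈ ρ.config i)
    (h : s' ∈ ρ.model i (s.1, shiftItv s.2 (θ.time (i + 1) - θ.time i))) : ρ.Edge i s s' :=
  ⟨hs, ρ.mem_config_succ hs h, s'.2, h, subset_rfl⟩

/-- In an accepting run, a branch starting at any level visits accepting locations
infinitely often. -/
theorem FRun.Accepting.exists_mem_final {A L : Type*} {Aut : OCATA A L} {θ : TimedWord A}
    {ρ : FRun Aut IdApprox θ} (hρ : ρ.Accepting) (i : ℕ) (β : ℕ → OState L)
    (hβ : ∀ k, ρ.Edge (i + k) (β k) (β (k + 1))) (N : ℕ) : ∃ k, N ≤ k ∧ (β k).1 ∈ Aut.final := by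
  induction i generalizing β N with
  | zero =>
    refine hρ β ⟨?_, fun k => by simpa using hβ k⟩ N
    have h := (hβ 0).1
    rw [Nat.zero_add, ρ.init] at h
    exact h
  | succ i ih =>
    have h := (hβ 0).1
    rw [Nat.add_zero, ρ.config_succ] at h
    simp only [mem_iUnion] at h
    obtain ⟨_, ⟨s, hs, rfl⟩, h⟩ := h
    obtain ⟨k, hk, hf⟩ := ih (fun k => Nat.casesOn k s β) (fun k => by
      cases k with
      | zero => exact ρ.edge_of_mem_model hs h
      | succ k =>
        have := hβ k
        rwa [show i + 1 + k = i + (k + 1) by omega] at this) (N + 1)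
    obtain ⟨k, rfl⟩ : ∃ m, k = m + 1 := ⟨k - 1, by omega⟩
    exact ⟨k, by omega, hf⟩

/-! ### Accepting runs give satisfaction -/

theorem FRun.models_of_mem_config {A : Type*} [DecidableEq A] {φ : MTL A} {θ : TimedWord A}
    (ρ : FRun (mtlOCATA φ) IdApprox θ) {i : ℕ} {v : ℝ}
    (p : {ψ : MTL A // ψ ∈ MTL.Subf φ ∧ ψ.IsTemporal}) (h : (some p, {v}) ∈ ρ.config i) :
    Models (ρ.model i (some p, {v + (θ.time (i + 1) - θ.time i)}))
      ((MTL.trans p.1 (θ.letter (i + 1))).map (embedLoc φ))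
      {v + (θ.time (i + 1) - θ.time i)} := by
  have := (ρ.minModel i _ (mem_shiftCfg h _)).1
  rwa [shiftItv_singleton] at this

theorem FRun.Accepting.oblNext {A : Type*} [DecidableEq A] {φ : MTL A} (hφ : φ.IsNNF)
    {θ : TimedWord A} {ρ : FRun (mtlOCATA φ) IdApprox θ} (hρ : ρ.Accepting) (χ : MTL A)
    (hχ : χ ∈ MTL.Subf φ ∧ χ.IsTemporal) (i : ℕ) (v : ℝ)
    (h : (some ⟨χ, hχ⟩, {v}) ∈ ρ.config i) : χ.OblNext θ i v := by
  have hnnf := hφ.of_temporal_mem_subf hχ.1 hχ.2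
  have key (ψ : MTL A) (hlt : sizeOf ψ < sizeOf χ) (hsub : MTL.Subf ψ ⊆ MTL.Subf χ)
      (hψ : ψ.IsNNF) (i : ℕ) (v : ℝ) (h : (some ⟨χ, hχ⟩, {v}) ∈ ρ.config i)
      (hm : Models (ρ.model i (some ⟨χ, hχ⟩, {v + (θ.time (i + 1) - θ.time i)}))
        ((MTL.trans ψ (θ.letter (i + 1))).map (embedLoc φ)) {0}) : MTL.Sat θ ψ (i + 1) := by
    refine MTL.sat_of_models_trans hψ (fun ξ hξ hξt hmem => ?_) hm
    have hξφ : ξ ∈ MTL.Subf φ ∧ ξ.IsTemporal := ⟨MTL.subf_trans hχ.1 (hsub hξ), hξt⟩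
    have := MTL.sizeOf_le_of_mem_subf hξ
    rw [embedLoc_val ⟨ξ, hξφ⟩, ← shiftItv_singleton] at hmem
    exact FRun.Accepting.oblNext hφ hρ ξ hξφ (i + 1) 0 (ρ.mem_config_succ h hmem)
  cases χ with
  | untl φ₁ φ₂ I =>
    have key₁ := key φ₁ (by simp only [MTL.untl.sizeOf_spec]; omega)
      (fun _ h => .inr (.inl h)) hnnf.1
    have key₂ := key φ₂ (by simp only [MTL.untl.sizeOf_spec]; omega)
      (fun _ h => .inr (.inr h)) hnnf.2
    by_contra hno
    set ℓ : MTLLoc φ := some ⟨_, hχ⟩ with hℓ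
    have step (i : ℕ) (v : ℝ) (h : (ℓ, {v}) ∈ ρ.config i)
        (hno : ¬ (MTL.untl φ₁ φ₂ I).OblNext θ i v) :
        ρ.Edge i (ℓ, {v}) (ℓ, {v + (θ.time (i + 1) - θ.time i)}) ∧
        ¬ (MTL.untl φ₁ φ₂ I).OblNext θ (i + 1) (v + (θ.time (i + 1) - θ.time i)) := by
      have hm := ρ.models_of_mem_config _ h
      rw [models_trans_untl] at hm
      rw [MTL.OblNext, MTL.obl_untl, not_or] at hno
      rcases hm with ⟨h₂, hI⟩ | ⟨h₁, hl, hI⟩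
      · exact (hno.1 ⟨key₂ i v h h₂, hI⟩).elim
      · refine ⟨ρ.edge_of_mem_model h ?_, fun ho => hno.2 ⟨key₁ i v h h₁, ho, hI⟩⟩
        rw [embedLoc_val ⟨_, hχ⟩] at hl
        rwa [shiftItv_singleton]
    have inv (k : ℕ) : (ℓ, {v + (θ.time (i + k) - θ.time i)}) ∈ ρ.config (i + k) ∧
        ¬ (MTL.untl φ₁ φ₂ I).OblNext θ (i + k) (v + (θ.time (i + k) - θ.time i)) := by
      induction k with
      | zero => simpa using ⟨h, hno⟩
      | succ k ih =>
        have := step _ _ ih.1 ih.2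
        rw [show v + (θ.time (i + k) - θ.time i) + (θ.time (i + k + 1) - θ.time (i + k)) =
          v + (θ.time (i + (k + 1)) - θ.time i) by rw [← Nat.add_assoc]; ring] at this
        exact ⟨this.1.2.1, this.2⟩
    obtain ⟨k, -, p, hp, hf⟩ := hρ.exists_mem_final i
      (fun k => (ℓ, {v + (θ.time (i + k) - θ.time i)})) (fun k => by
        have := (step _ _ (inv k).1 (inv k).2).1
        rwa [show v + (θ.time (i + k) - θ.time i) + (θ.time (i + k + 1) - θ.time (i + k)) =
          v + (θ.time (i + (k + 1)) - θ.time i) by rw [← Nat.add_assoc]; ring] at this) 0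
    obtain rfl := Option.some.inj hp
    exact hf
  | rele φ₁ φ₂ I =>
    have key₁ := key φ₁ (by simp only [MTL.rele.sizeOf_spec]; omega)
      (fun _ h => .inr (.inl h)) hnnf.1
    have key₂ := key φ₂ (by simp only [MTL.rele.sizeOf_spec]; omega)
      (fun _ h => .inr (.inr h)) hnnf.2
    rintro ⟨j, hj, hQ, hI, hP⟩
    obtain ⟨d, rfl⟩ := Nat.exists_eq_add_of_le hj
    induction d generalizing i v with
    | zero =>
      have hm := ρ.models_of_mem_config _ h
      rw [models_trans_rele] at hm
      rcases hm.1 with h₂ | h₂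
      · exact hQ (key₂ i v h h₂)
      · exact h₂ (by simpa using hI)
    | succ d ih =>
      have hm := ρ.models_of_mem_config _ h
      rw [models_trans_rele] at hm
      rcases hm.2 with h₁ | hl | hs
      · exact hP (i + 1) le_rfl (by omega) (key₁ i v h h₁)
      · rw [embedLoc_val ⟨_, hχ⟩, ← shiftItv_singleton] at hl
        have hl' := ρ.mem_config_succ h hl
        rw [shiftItv_singleton] at hl'
        have e : i + 1 + 1 + d = i + 1 + (d + 1) := by omega
        refine ih (i + 1) _ hl' (by omega) (by rwa [e]) ?_ fun k h1 h2 => hP k (by omega) (by omega)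
        rw [e]
        convert hI using 1
        ring
      · exact hs (hI.leSup (by linarith [θ.mono hj]))
  | _ => exact hχ.2.elim
termination_by sizeOf χ

/-! ### Satisfaction gives accepting runs -/

/-- The size of a location. -/
noncomputable def locSize {A : Type*} {φ : MTL A} : MTLLoc φ → ℕ
  | none => sizeOf φ + 1
  | some p => sizeOf p.1

/-- The states of level `i` carrying a true obligation. -/
def GoodState {A : Type*} {φ : MTL A} (θ : TimedWord A) (i : ℕ) (s : OState (MTLLoc φ)) : Prop :=
  match s.1 with
  | none => i = 0 ∧ s.2 = {0}
  | some p => ∃ v : ℝ, 0 ≤ v ∧ s.2 = {v} ∧ p.1.OblNext θ i v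

/-- The obligation of an until formula with clock value in `J` is fulfilled at position `n`. -/
def Fulfilled {A : Type*} (θ : TimedWord A) (n : ℕ) (ψ : MTL A) (J : Set ℝ) : Prop :=
  match ψ with
  | .untl _ φ₂ I => MTL.Sat θ φ₂ n ∧ ∀ w ∈ J, I.Mem w
  | _ => False

/-- The successors used at level `i` for the (shifted) state `s`: true obligations that are
either freshly reset and smaller, or equal to `s` when `s` is not fulfilled yet. -/
def targets {A : Type*} {φ : MTL A} (θ : TimedWord A) (i : ℕ) (s : OState (MTLLoc φ)) :
    Set (OState (MTLLoc φ)) :=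
  {s' | GoodState θ (i + 1) s' ∧ ((locSize s'.1 < locSize s.1 ∧ s'.2 = {0}) ∨
    (s' = s ∧ ∀ p, s.1 = some p → ¬ Fulfilled θ (i + 1) p.1 s.2))}

theorem targets_finite {A : Type*} {φ : MTL A} (θ : TimedWord A) (i : ℕ)
    (s : OState (MTLLoc φ)) : (targets θ i s).Finite := by
  refine ((Set.finite_univ (α := MTLLoc φ)).prod (Set.toFinite {{0}, s.2})).subset ?_
  rintro s' ⟨-, ⟨-, h⟩ | ⟨rfl, -⟩⟩
  · exact ⟨trivial, .inl h⟩
  · exact ⟨trivial, .inr rfl⟩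

theorem models_targets {A : Type*} [DecidableEq A] {φ : MTL A} (hφ : φ.IsNNF) {θ : TimedWord A}
    (hθ : MTL.Sat θ φ 1) {i : ℕ} {s : OState (MTLLoc φ)} (hs : GoodState θ i s) :
    Models (targets θ i (s.1, shiftItv s.2 (θ.time (i + 1) - θ.time i)))
      ((mtlOCATA φ).δ s.1 (θ.letter (i + 1))) (shiftItv s.2 (θ.time (i + 1) - θ.time i)) := by
  set s₁ : OState (MTLLoc φ) := (s.1, shiftItv s.2 (θ.time (i + 1) - θ.time i)) with hs₁
  have key (χ : MTL A) (hχ : χ ∈ MTL.Subf φ) (hχt : χ.IsTemporal)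
      (hlt : sizeOf χ < locSize s.1) (ho : χ.OblNext θ (i + 1) 0) :
      (embedLoc φ χ, {0}) ∈ targets θ i s₁ := by
    rw [embedLoc_val ⟨χ, hχ, hχt⟩]
    exact ⟨⟨0, le_rfl, rfl, ho⟩, .inl ⟨hlt, rfl⟩⟩
  rcases s with ⟨_ | ⟨ψ, hψ⟩, J⟩
  · obtain ⟨rfl, -⟩ := hs
    refine MTL.models_trans_of_sat hφ (fun χ hχ hχt => key χ hχ hχt ?_) hθ
    exact Nat.lt_succ_of_le (MTL.sizeOf_le_of_mem_subf hχ)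
  · obtain ⟨v, hv, hJ, ho⟩ := hs
    obtain rfl : J = {v} := hJ
    simp only [shiftItv_singleton] at hs₁ ⊢
    have hnnf := hφ.of_temporal_mem_subf hψ.1 hψ.2
    have sub (ξ : MTL A) (hlt : sizeOf ξ < sizeOf ψ) (hsub : MTL.Subf ξ ⊆ MTL.Subf ψ)
        (hξ : ξ.IsNNF) (hsat : MTL.Sat θ ξ (i + 1)) : Models (targets θ i s₁)
          ((MTL.trans ξ (θ.letter (i + 1))).map (embedLoc φ)) {0} :=
      MTL.models_trans_of_sat hξ (fun χ hχ hχt =>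
        key χ (MTL.subf_trans hψ.1 (hsub hχ)) hχt
          ((MTL.sizeOf_le_of_mem_subf hχ).trans_lt hlt)) hsat
    have nonneg : 0 ≤ v + (θ.time (i + 1) - θ.time i) := by
      linarith [θ.mono (Nat.le_succ i)]
    have stay (hn : ψ.OblNext θ (i + 1) (v + (θ.time (i + 1) - θ.time i)))
        (hf : ¬ Fulfilled θ (i + 1) ψ {v + (θ.time (i + 1) - θ.time i)}) :
        (embedLoc φ ψ, {v + (θ.time (i + 1) - θ.time i)}) ∈ targets θ i s₁ := by
      rw [embedLoc_val ⟨ψ, hψ⟩]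
      refine ⟨⟨_, nonneg, rfl, hn⟩, .inr ⟨hs₁.symm, ?_⟩⟩
      rintro p hp
      rw [hs₁] at hp ⊢
      obtain rfl := Option.some.inj hp
      exact hf
    cases ψ with
    | untl φ₁ φ₂ I =>
      refine (models_trans_untl _ _ _ _ _ _ _).2 ?_
      rw [MTL.OblNext, MTL.obl_untl] at ho
      have h₁ := sub φ₁ (by simp only [MTL.untl.sizeOf_spec]; omega)
        (fun _ h => .inr (.inl h)) hnnf.1
      have h₂ := sub φ₂ (by simp only [MTL.untl.sizeOf_spec]; omega)
        (fun _ h => .inr (.inr h)) hnnf.2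
      by_cases hf : MTL.Sat θ φ₂ (i + 1) ∧ I.Mem (v + (θ.time (i + 1) - θ.time i))
      · exact .inl ⟨h₂ hf.1, hf.2⟩
      · obtain ⟨hs, hn, hI⟩ := ho.resolve_left hf
        exact .inr ⟨h₁ hs, stay hn fun h => hf ⟨h.1, h.2 _ rfl⟩, hI⟩
    | rele φ₁ φ₂ I =>
      refine (models_trans_rele _ _ _ _ _ _ _).2 ?_
      rw [MTL.OblNext, MTL.obl_rele] at ho
      have h₁ := sub φ₁ (by simp only [MTL.rele.sizeOf_spec]; omega)
        (fun _ h => .inr (.inl h)) hnnf.1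
      have h₂ := sub φ₂ (by simp only [MTL.rele.sizeOf_spec]; omega)
        (fun _ h => .inr (.inr h)) hnnf.2
      exact ho.imp (Or.imp_left h₂) (Or.imp h₁ (Or.imp_left fun hn => stay hn id))
    | _ => exact hψ.2.elim

theorem GoodState.exists_eq_singleton {A : Type*} {φ : MTL A} {θ : TimedWord A} {i : ℕ}
    {s : OState (MTLLoc φ)} (hs : GoodState θ i s) : ∃ v : ℝ, 0 ≤ v ∧ s.2 = {v} := by
  rcases s with ⟨_ | p, J⟩
  · exact ⟨0, le_rfl, hs.2⟩
  · obtain ⟨v, hv, hJ, -⟩ := hs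
    exact ⟨v, hv, hJ⟩

theorem isConfig_of_goodState {A : Type*} {φ : MTL A} {θ : TimedWord A} {i : ℕ}
    {C : Set (OState (MTLLoc φ))} (hfin : C.Finite) (hC : ∀ s ∈ C, GoodState θ i s) :
    IsConfig C := by
  refine ⟨hfin, fun s hs => ?_, fun ℓ I J hI hJ hne => ?_⟩
  · obtain ⟨v, hv, e⟩ := (hC s hs).exists_eq_singleton
    rw [e]
    exact ⟨singleton_nonempty v, ordConnected_singleton, bddAbove_singleton, by simpa using hv⟩
  · obtain ⟨v, -, e⟩ := (hC _ hI).exists_eq_singleton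
    obtain ⟨w, -, e'⟩ := (hC _ hJ).exists_eq_singleton
    obtain rfl : I = {v} := e
    obtain rfl : J = {w} := e'
    rw [disjoint_singleton]
    rintro rfl
    exact hne rfl

theorem exists_run_model_subset_targets {A : Type*} [DecidableEq A] {φ : MTL A} (hφ : φ.IsNNF)
    {θ : TimedWord A} (hθ : MTL.Sat θ φ 1) : ∃ ρ : FRun (mtlOCATA φ) IdApprox θ,
      (∀ i, ∀ s ∈ ρ.config i, GoodState θ i s) ∧
      ∀ i, ∀ s ∈ ρ.config i, ρ.model i (s.1, shiftItv s.2 (θ.time (i + 1) - θ.time i)) ⊆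
        targets θ i (s.1, shiftItv s.2 (θ.time (i + 1) - θ.time i)) := by
  have hex (i : ℕ) (s : OState (MTLLoc φ)) : ∃ M : Set (OState (MTLLoc φ)),
      M ⊆ targets θ i s ∧ (Models (targets θ i s) ((mtlOCATA φ).δ s.1 (θ.letter (i + 1))) s.2 →
        IsMinModel M ((mtlOCATA φ).δ s.1 (θ.letter (i + 1))) s.2) := by
    by_cases h : Models (targets θ i s) ((mtlOCATA φ).δ s.1 (θ.letter (i + 1))) s.2
    · obtain ⟨M, hM, hmin⟩ := h.exists_isMinModel_subset (targets_finite θ i s)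
      exact ⟨M, hM, fun _ => hmin⟩
    · exact ⟨∅, empty_subset _, fun h' => (h h').elim⟩
  choose model hsub hmin using hex
  let config : ℕ → Set (OState (MTLLoc φ)) := fun i => Nat.rec {(none, zeroItv)}
    (fun i C => ⋃ s ∈ shiftCfg C (θ.time (i + 1) - θ.time i), model i s) i
  have inv (i : ℕ) : (config i).Finite ∧ ∀ s ∈ config i, GoodState θ i s := by
    induction i with
    | zero =>
      refine ⟨finite_singleton _, ?_⟩
      rintro _ rfl
      exact ⟨rfl, rfl⟩
    | succ i ih =>
      refine ⟨(ih.1.image _).biUnion fun s _ => (targets_finite θ i s).subset (hsub i s), ?_⟩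
      intro s hs
      obtain ⟨s', -, h⟩ := mem_iUnion₂.1 hs
      exact (hsub i s' h).1
  refine ⟨⟨config, model, rfl, fun i => isConfig_of_goodState (inv i).1 (inv i).2, ?_,
    fun i => rfl⟩, fun i => (inv i).2, fun i s _ => hsub i _⟩
  rintro i _ ⟨s, hs, rfl⟩
  exact hmin i _ (models_targets hφ hθ ((inv i).2 s hs))

theorem FRun.accepting_of_model_subset_targets {A : Type*} [DecidableEq A] {φ : MTL A}
    {θ : TimedWord A} (ρ : FRun (mtlOCATA φ) IdApprox θ)
    (hgood : ∀ i, ∀ s ∈ ρ.config i, GoodState θ i s)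
    (hsub : ∀ i, ∀ s ∈ ρ.config i, ρ.model i (s.1, shiftItv s.2 (θ.time (i + 1) - θ.time i)) ⊆
      targets θ i (s.1, shiftItv s.2 (θ.time (i + 1) - θ.time i))) : ρ.Accepting := by
  rintro β ⟨-, hβ⟩ N
  by_contra! hN
  have hstep (i : ℕ) : β (i + 1) ∈
      targets θ i ((β i).1, shiftItv (β i).2 (θ.time (i + 1) - θ.time i)) := by
    obtain ⟨h₀, h₁, I, hI, hsubI⟩ := hβ i
    have hmem := hsub i _ h₀ hI
    obtain ⟨v, -, e⟩ := (hgood _ _ h₁).exists_eq_singleton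
    obtain ⟨w, -, e'⟩ := hmem.1.exists_eq_singleton
    have : I = (β (i + 1)).2 := by
      simp only at e'
      rw [e, e', singleton_subset_iff, mem_singleton_iff] at hsubI
      rw [e, e', hsubI]
    rw [this] at hmem
    exact hmem
  obtain ⟨i₀, hi₀, hmin⟩ : ∃ i₀, N + 1 ≤ i₀ ∧
      ∀ i, N + 1 ≤ i → locSize (β i₀).1 ≤ locSize (β i).1 := by
    have hne : {i | N + 1 ≤ i}.Nonempty := nonempty_Ici
    exact ⟨_, Function.argminOn_mem (fun i => locSize (β i).1) _ hne,
      fun i hi => Function.argminOn_le (fun i => locSize (β i).1) {i | N + 1 ≤ i} hi⟩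
  have hstay (i : ℕ) (hi : i₀ ≤ i) (hloc : (β i).1 = (β i₀).1) :
      β (i + 1) = ((β i).1, shiftItv (β i).2 (θ.time (i + 1) - θ.time i)) ∧
      ∀ p, (β i).1 = some p →
        ¬ Fulfilled θ (i + 1) p.1 (shiftItv (β i).2 (θ.time (i + 1) - θ.time i)) := by
    refine (hstep i).2.resolve_left fun h => ?_
    have := hmin (i + 1) (by omega)
    rw [← hloc] at this
    exact absurd h.1 (by simpa using this)
  have hloc (i : ℕ) (hi : i₀ ≤ i) : (β i).1 = (β i₀).1 := by
    induction i, hi using Nat.le_induction with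
    | base => rfl
    | succ i hi ih => rw [(hstay i hi ih).1, ih]
  have hg := hgood _ _ (hβ i₀).1
  have hnf := hN i₀ (by omega)
  unfold GoodState at hg
  rcases hb : (β i₀).1 with _ | ⟨ψ, hψ⟩
  · rw [hb] at hg
    have := hg.1
    omega
  · rw [hb] at hg hnf
    obtain ⟨v, -, hv, ho⟩ := hg
    cases ψ with
    | untl φ₁ φ₂ I =>
      obtain ⟨j, hj, hQ, hI, -⟩ := ho
      have hclock (i : ℕ) (hi : i₀ ≤ i) : (β i).2 = {v + (θ.time i - θ.time i₀)} := by
        induction i, hi using Nat.le_induction with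
        | base => simpa using hv
        | succ i hi ih =>
          rw [(hstay i hi (hloc i hi)).1, ih]
          simp only [shiftItv_singleton]
          ring_nf
      obtain ⟨i, rfl⟩ : ∃ i, j = i + 1 := ⟨j - 1, by omega⟩
      have hi : i₀ ≤ i := by omega
      refine (hstay i hi (hloc i hi)).2 _ ((hloc i hi).trans hb) ⟨hQ, ?_⟩
      rw [hclock i hi, shiftItv_singleton]
      rintro w rfl
      convert hI using 1
      ring
    | rele φ₁ φ₂ I => exact hnf ⟨_, rfl, trivial⟩
    | _ => exact hψ.2.elim

/-- For every MTL formula `φ` in negative normal form,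
`L^ω(A_φ) = ⟦φ⟧`. -/
theorem mtlOCATA_lang {A : Type*} [Finite A] [DecidableEq A] (φ : MTL A)
    (hφ : MTL.IsNNF φ) :
    FLang (mtlOCATA φ) IdApprox = MTL.SemLang φ := by
  ext θ
  constructor
  · rintro ⟨ρ, hρ⟩
    have hinit : ((none : MTLLoc φ), zeroItv) ∈ ρ.config 0 := by
      rw [ρ.init]
      rfl
    refine MTL.sat_of_models_trans hφ (fun χ hχ hχt hmem => ?_)
      (ρ.minModel 0 _ (mem_shiftCfg hinit _)).1
    rw [embedLoc_val ⟨χ, hχ, hχt⟩] at hmem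
    exact hρ.oblNext hφ χ ⟨hχ, hχt⟩ 1 0 (ρ.mem_config_succ hinit hmem)
  · intro hθ
    obtain ⟨ρ, hgood, hsub⟩ := exists_run_model_subset_targets hφ hθ
    exact ⟨ρ, ρ.accepting_of_model_subset_targets hgood hsub⟩

end OcataPaper
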